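/- Let m, n ≥ 2 and let P : ℝ^{m×n} → ℝ^{2×2} be the linear projection sending a matrix M to its top-left 2×2 block [M₁₁ M₁₂; M₂₁ M₂₂]. If g : ℝ^{2×2} → ℝ is a continuous quasiconvex function of linear growth, then g ∘ P : ℝ^{m×n} → ℝ is quasiconvex: for every z ∈ ℝ^{m×n} and every smooth compactly supported φ : Q → ℝ^m with Q = (0,1)^n the open unit cube, ∫_Q g(P(z + Dφ(x))) dx ≥ g(P(z)). -/

import Mathlib

open MeasureTheory

/-- The open unit cube `(0,1)^n` in `ℝⁿ`. -/
def unitCube (n : ℕ) : Set (Fin n → ℝ) := Set.univ.pi fun _ => Set.Ioo (0 : ℝ) 1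

/-- The Jacobian matrix of a map `φ : ℝⁿ → ℝᵐ` at a point `x`. -/
noncomputable def jacobianMatrix {m n : ℕ} (φ : (Fin n → ℝ) → (Fin m → ℝ))
    (x : Fin n → ℝ) : Matrix (Fin m) (Fin n) ℝ :=
  Matrix.of fun i j => fderiv ℝ φ x (Pi.single j 1) i

/-- A continuous function on `m×n` matrices is quasiconvex if it satisfies Jensen's
inequality against gradients of smooth compactly supported test maps on the unit cube. -/
def IsQuasiconvex {m n : ℕ} (f : Matrix (Fin m) (Fin n) ℝ → ℝ) : Prop :=
  ∀ z : Matrix (Fin m) (Fin n) ℝ, ∀ φ : (Fin n → ℝ) → (Fin m → ℝ),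
    ContDiff ℝ (⊤ : ℕ∞) φ → HasCompactSupport φ → tsupport φ ⊆ unitCube n →
    f z ≤ ∫ x in unitCube n, f (z + jacobianMatrix φ x)

/-- The Euclidean (Frobenius) norm of a matrix. -/
noncomputable def frobNorm {m n : ℕ} (z : Matrix (Fin m) (Fin n) ℝ) : ℝ :=
  Real.sqrt (∑ i, ∑ j, (z i j) ^ 2)

/-- `f` has linear growth. -/
def HasLinearGrowth {m n : ℕ} (f : Matrix (Fin m) (Fin n) ℝ → ℝ) : Prop :=
  ∃ C : ℝ, 0 ≤ C ∧ ∀ z, |f z| ≤ C * (1 + frobNorm z)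

/-- The metric `d(f,g) = sup_z |f(z)-g(z)|/(1+|z|)` on functions of linear growth. -/
noncomputable def dLG {m n : ℕ} (f g : Matrix (Fin m) (Fin n) ℝ → ℝ) : ℝ :=
  ⨆ z : Matrix (Fin m) (Fin n) ℝ, |f z - g z| / (1 + frobNorm z)

/-- The cube `(0,1)^n` has volume one. -/
theorem volume_unitCube (n : ℕ) : volume (unitCube n) = 1 := by
  simp [unitCube, Real.volume_pi_Ioo]

/-- A continuous function is integrable on the unit cube. -/
theorem Continuous.integrableOn_unitCube {n : ℕ} {F : (Fin n → ℝ) → ℝ} (hF : Continuous F) :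
    IntegrableOn F (unitCube n) := by
  have hK : IsCompact (Set.univ.pi fun _ : Fin n => Set.Icc (0 : ℝ) 1) :=
    isCompact_univ_pi fun _ => isCompact_Icc
  exact (hF.continuousOn.integrableOn_compact hK).mono_set
    (Set.pi_mono fun _ _ => Set.Ioo_subset_Icc_self)

/-- Concatenation of tuples preserves Lebesgue measure. -/
theorem measurePreserving_finAppend (k l : ℕ) :
    MeasurePreserving (fun p : (Fin k → ℝ) × (Fin l → ℝ) => Fin.append p.1 p.2)
      (volume.prod volume) volume := by
  have h := (volume_measurePreserving_piCongrLeft (fun _ : Fin (k + l) => ℝ)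
    finSumFinEquiv).comp
    (volume_measurePreserving_sumPiEquivProdPi_symm (fun _ : Fin k ⊕ Fin l => ℝ))
  refine (funext fun p => funext fun i => ?_ : (fun p : (Fin k → ℝ) × (Fin l → ℝ) =>
    Fin.append p.1 p.2) = _) ▸ h
  obtain ⟨s, rfl⟩ := finSumFinEquiv.surjective i
  rw [Function.comp_apply, MeasurableEquiv.coe_piCongrLeft, Equiv.piCongrLeft_apply_apply]
  cases s <;> simp [MeasurableEquiv.coe_sumPiEquivProdPi_symm]

/-- Concatenation of tuples is a measurable embedding. -/
theorem measurableEmbedding_finAppend (k l : ℕ) :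
    MeasurableEmbedding (fun p : (Fin k → ℝ) × (Fin l → ℝ) => Fin.append p.1 p.2) := by
  refine (measurePreserving_finAppend k l).measurable.measurableEmbedding ?_
  rintro ⟨a, b⟩ ⟨c, d⟩ h
  refine Prod.ext (funext fun i => ?_) (funext fun i => ?_)
  · simpa using congrFun h (Fin.castAdd l i)
  · simpa using congrFun h (Fin.natAdd k i)

theorem finAppend_mem_unitCube {k l : ℕ} (x : Fin k → ℝ) (y : Fin l → ℝ) :
    Fin.append x y ∈ unitCube (k + l) ↔ x ∈ unitCube k ∧ y ∈ unitCube l := by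
  simp only [unitCube, Set.mem_univ_pi, Fin.forall_fin_add, Fin.append_left, Fin.append_right]

theorem preimage_finAppend_unitCube (k l : ℕ) :
    (fun p : (Fin k → ℝ) × (Fin l → ℝ) => Fin.append p.1 p.2) ⁻¹' unitCube (k + l) =
      unitCube k ×ˢ unitCube l := by
  ext p
  exact finAppend_mem_unitCube p.1 p.2

/-- If all `k`-dimensional slices of `F` have integral at least `c` over the unit cube, then so
does `F`. -/
theorem le_integral_unitCube_of_forall_slice {k l : ℕ} {F : (Fin (k + l) → ℝ) → ℝ}
    (hF : Continuous F) (c : ℝ)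
    (h : ∀ y : Fin l → ℝ, c ≤ ∫ x in unitCube k, F (Fin.append x y)) :
    c ≤ ∫ x in unitCube (k + l), F x := by
  have hmp := measurePreserving_finAppend k l
  have hme := measurableEmbedding_finAppend k l
  have hint : IntegrableOn (fun p : (Fin k → ℝ) × (Fin l → ℝ) => F (Fin.append p.1 p.2))
      (unitCube k ×ˢ unitCube l) (volume.prod volume) := by
    rw [← preimage_finAppend_unitCube]
    exact (hmp.integrableOn_comp_preimage hme).2 hF.integrableOn_unitCube
  rw [← hmp.setIntegral_preimage_emb hme, preimage_finAppend_unitCube,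
    ← Measure.prod_restrict]
  rw [IntegrableOn, ← Measure.prod_restrict] at hint
  rw [integral_prod_symm _ hint]
  calc c = ∫ _ in unitCube l, c := by simp [Measure.real, volume_unitCube]
    _ ≤ _ := by
      refine integral_mono ?_ hint.integral_prod_right h
      exact integrableOn_const (by simp [volume_unitCube])

/-- The linear inclusion of `ℝᵏ` into `ℝᵏ⁺ˡ` along the first `k` coordinates. -/
noncomputable def inclLeft (k l : ℕ) : (Fin k → ℝ) →L[ℝ] (Fin (k + l) → ℝ) :=
  ContinuousLinearMap.pi
    (Fin.addCases (fun i => ContinuousLinearMap.proj i) fun _ => 0)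

theorem inclLeft_add_append {k l : ℕ} (x : Fin k → ℝ) (y : Fin l → ℝ) :
    inclLeft k l x + Fin.append 0 y = Fin.append x y := by
  funext i
  refine Fin.addCases (fun i => ?_) (fun i => ?_) i <;> simp [inclLeft]

theorem inclLeft_single {k l : ℕ} (j : Fin k) :
    inclLeft k l (Pi.single j 1) = Pi.single (Fin.castAdd l j) 1 := by
  funext i
  refine Fin.addCases (fun i => ?_) (fun i => ?_) i
  · simp [inclLeft, Pi.single_apply]
  · have : Fin.natAdd k i ≠ Fin.castAdd l j := by
      intro h
      have := congrArg Fin.val h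
      simp at this
      omega
    simp [inclLeft, this]

/-- The Jacobian of a smooth map is continuous. -/
theorem continuous_jacobianMatrix {m n : ℕ} {φ : (Fin n → ℝ) → (Fin m → ℝ)}
    (hφ : ContDiff ℝ (⊤ : ℕ∞) φ) : Continuous (jacobianMatrix φ) := by
  have hd : Continuous (fderiv ℝ φ) := hφ.continuous_fderiv (by simp)
  refine continuous_matrix fun i j => ?_
  exact (continuous_apply i).comp (hd.clm_apply continuous_const)

/-- The restriction of the first components of `φ` to a slice is a test map whose Jacobian is
a block of the Jacobian of `φ`. -/
theorem jacobianMatrix_slice {m k l p : ℕ} (hp : p ≤ m)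
    {φ : (Fin (k + l) → ℝ) → (Fin m → ℝ)} (hφ : Differentiable ℝ φ)
    (x : Fin k → ℝ) (y : Fin l → ℝ) :
    jacobianMatrix (fun x (i : Fin p) => φ (inclLeft k l x + Fin.append 0 y) (Fin.castLE hp i)) x =
      Matrix.of fun i j =>
        jacobianMatrix φ (Fin.append x y) (Fin.castLE hp i) (Fin.castAdd l j) := by
  have hL : HasFDerivAt (fun x => inclLeft k l x + Fin.append 0 y) (inclLeft k l) x :=
    (inclLeft k l).hasFDerivAt.add_const _
  have hc := (hφ _).hasFDerivAt.comp x hL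
  have hR : HasFDerivAt
      (fun x (i : Fin p) => φ (inclLeft k l x + Fin.append 0 y) (Fin.castLE hp i))
      (ContinuousLinearMap.pi fun i => (ContinuousLinearMap.proj (Fin.castLE hp i)).comp
        ((fderiv ℝ φ (inclLeft k l x + Fin.append 0 y)).comp (inclLeft k l))) x :=
    hasFDerivAt_pi.2 fun i => hasFDerivAt_pi'.1 hc (Fin.castLE hp i)
  ext i j
  rw [jacobianMatrix, hR.fderiv]
  simp [jacobianMatrix, inclLeft_single, inclLeft_add_append]

theorem tsupport_slice_subset {m k l p : ℕ} (hp : p ≤ m)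
    {φ : (Fin (k + l) → ℝ) → (Fin m → ℝ)} (hφ : tsupport φ ⊆ unitCube (k + l))
    (y : Fin l → ℝ) :
    tsupport (fun x (i : Fin p) => φ (inclLeft k l x + Fin.append 0 y) (Fin.castLE hp i)) ⊆
      unitCube k := by
  have hcont : Continuous fun x => inclLeft k l x + Fin.append 0 y := by fun_prop
  have hsub : tsupport
      (fun x (i : Fin p) => φ (inclLeft k l x + Fin.append 0 y) (Fin.castLE hp i)) ⊆
        (fun x => inclLeft k l x + Fin.append 0 y) ⁻¹' tsupport φ := by
    refine closure_minimal (fun x hx => subset_tsupport φ fun h => hx ?_)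
      ((isClosed_tsupport φ).preimage hcont)
    funext i
    exact congrFun h (Fin.castLE hp i)
  intro x hx
  have : inclLeft k l x + Fin.append 0 y ∈ unitCube (k + l) := hφ (hsub hx)
  rw [inclLeft_add_append, finAppend_mem_unitCube] at this
  exact this.1

theorem hasCompactSupport_of_tsupport_subset_unitCube {n : ℕ} {E : Type*} [Zero E]
    {ψ : (Fin n → ℝ) → E} (h : tsupport ψ ⊆ unitCube n) : HasCompactSupport ψ :=
  (isCompact_univ_pi fun _ : Fin n => isCompact_Icc (a := (0 : ℝ)) (b := 1)).of_isClosed_subset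
    (isClosed_tsupport ψ) (h.trans (Set.pi_mono fun _ _ => Set.Ioo_subset_Icc_self))

/-- Precomposition with the projection onto the top-left `2×2` block preserves
quasiconvexity: if `g : ℝ^{2×2} → ℝ` is continuous, quasiconvex and of linear growth, then
`g ∘ P : ℝ^{m×n} → ℝ` is quasiconvex (for `m, n ≥ 2`). -/
theorem quasiconvex_comp_block_projection (m n : ℕ) (hm : 2 ≤ m) (hn : 2 ≤ n)
    (g : Matrix (Fin 2) (Fin 2) ℝ → ℝ)
    (hgc : Continuous g) (hgqc : IsQuasiconvex g) (hggrowth : HasLinearGrowth g) :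
    IsQuasiconvex (fun M : Matrix (Fin m) (Fin n) ℝ =>
      g (Matrix.of fun i j : Fin 2 => M (Fin.castLE hm i) (Fin.castLE hn j))) := by
  obtain ⟨l, rfl⟩ := Nat.exists_eq_add_of_le hn
  intro z φ hφ _ hsupp
  refine le_integral_unitCube_of_forall_slice ?_ _ fun y => ?_
  · have hJ := continuous_jacobianMatrix hφ
    refine hgc.comp (continuous_matrix fun i j => ?_)
    exact (continuous_const.add hJ).matrix_elem _ _
  · have hs := tsupport_slice_subset hm hsupp y
    have hsmooth : ContDiff ℝ (⊤ : ℕ∞)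
        (fun x (i : Fin 2) => φ (inclLeft 2 l x + Fin.append 0 y) (Fin.castLE hm i)) :=
      contDiff_pi.2 fun i => contDiff_pi.1
        (hφ.comp ((inclLeft 2 l).contDiff.add contDiff_const)) (Fin.castLE hm i)
    have h := hgqc (Matrix.of fun i j : Fin 2 => z (Fin.castLE hm i) (Fin.castLE hn j)) _
      hsmooth (hasCompactSupport_of_tsupport_subset_unitCube hs) hs
    simp_rw [jacobianMatrix_slice hm (hφ.differentiable (by simp))] at h
    exact h
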